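/- arXiv:1308.6627 — 7 statements merged into one kernel-verified Lean document; each statement's English description precedes it below -/
import Mathlib

section
/- Let n and i be natural numbers with i ≤ n, and let f : Fin n → Fin n be a function whose image has cardinality n − i. Then the number of pairs (x, y) ∈ Fin n × Fin n such that the function Function.update f x y (which agrees with f except that x is mapped to y) has image of cardinality n − i + 1 is at least i². Consequently, if x and y are chosen uniformly at random, the probability that redefining f(x) := y strictly increases the cardinality of the image is at least i²/n². -/
open Classical

/-- Redefining `f` at a point whose value is also attained elsewhere adds the new value to the
image and removes nothing. -/
theorem image_update_eq_insert {α β : Type*} [Fintype α] [DecidableEq α] [DecidableEq β]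
    {f : α → β} {x x' : α} (hne : x' ≠ x) (hf : f x' = f x) (y : β) :
    Finset.univ.image (Function.update f x y) = insert y (Finset.univ.image f) := by
  ext z
  simp only [Finset.mem_image, Finset.mem_univ, true_and, Finset.mem_insert]
  constructor
  · rintro ⟨a, rfl⟩
    by_cases h : a = x
    · simp [h]
    · exact Or.inr ⟨a, by simp [h]⟩
  · rintro (rfl | ⟨a, rfl⟩)
    · exact ⟨x, by simp⟩
    · by_cases h : a = x
      · exact ⟨x', by simp [hne, hf, h]⟩
      · exact ⟨a, by simp [h]⟩

/-- Every function on a finite type repeats its values on a set whose cardinality is the defect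
of the image. -/
theorem exists_finset_repeated_values {α β : Type*} [Fintype α] [DecidableEq α] [DecidableEq β]
    (f : α → β) :
    ∃ s : Finset α, s.card = Fintype.card α - (Finset.univ.image f).card ∧
      ∀ x ∈ s, ∃ x', x' ≠ x ∧ f x' = f x := by
  obtain ⟨t, -, hinj, himage⟩ := Finset.exists_subset_injOn_image_eq_of_surjOn
    Set.univ (Finset.univ.image f) (f := f) (by simp [Set.SurjOn])
  refine ⟨tᶜ, ?_, fun x hx => ?_⟩
  · rw [Finset.card_compl, ← himage, Finset.card_image_of_injOn hinj]
  · have hfx : f x ∈ t.image f := himage ▸ Finset.mem_image_of_mem f (Finset.mem_univ x)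
    obtain ⟨x', hx', hf⟩ := Finset.mem_image.mp hfx
    exact ⟨x', fun h => Finset.mem_compl.mp hx (h ▸ hx'), hf⟩

/-- If `f : Fin n → Fin n` has image of cardinality `n − i`, then at least `i²` of the
`n²` pairs `(x, y)` are such that updating `f` to send `x` to `y` increases the
cardinality of the image to `n − i + 1`; consequently a uniformly random update
strictly increases the image cardinality with probability at least `i²/n²`. -/
theorem update_increases_range
    (n i : ℕ) (hi : i ≤ n) (f : Fin n → Fin n)
    (himg : (Finset.univ.image f).card = n - i) :
    i ^ 2 ≤ ((Finset.univ ×ˢ Finset.univ).filter (fun p : Fin n × Fin n =>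
        (Finset.univ.image (Function.update f p.1 p.2)).card = n - i + 1)).card ∧
    (i : ℝ) ^ 2 / (n : ℝ) ^ 2 ≤
      (((Finset.univ ×ˢ Finset.univ).filter (fun p : Fin n × Fin n =>
        (Finset.univ.image (Function.update f p.1 p.2)).card = n - i + 1)).card : ℝ)
        / (n : ℝ) ^ 2 := by
  have hcount : i ^ 2 ≤ ((Finset.univ ×ˢ Finset.univ).filter (fun p : Fin n × Fin n =>
      (Finset.univ.image (Function.update f p.1 p.2)).card = n - i + 1)).card := by
    obtain ⟨s, hs, hrep⟩ := exists_finset_repeated_values f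
    rw [himg, Fintype.card_fin, Nat.sub_sub_self hi] at hs
    have hcompl : (Finset.univ.image f)ᶜ.card = i := by
      rw [Finset.card_compl, himg, Fintype.card_fin, Nat.sub_sub_self hi]
    calc i ^ 2 = (s ×ˢ (Finset.univ.image f)ᶜ).card := by
          rw [Finset.card_product, hs, hcompl, sq]
      _ ≤ _ := Finset.card_le_card ?_
    rintro ⟨x, y⟩ hxy
    obtain ⟨hx, hy⟩ := Finset.mem_product.mp hxy
    obtain ⟨x', hne, hf⟩ := hrep x hx
    refine Finset.mem_filter.mpr ⟨by simp, ?_⟩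
    rw [image_update_eq_insert hne hf, Finset.card_insert_of_notMem (Finset.mem_compl.mp hy),
      himg]
  refine ⟨hcount, ?_⟩
  gcongr
  exact_mod_cast hcount
end

section
/- Let c ≥ 1. The number of simple graphs G on V = Fin (2c) ⊕ Fin 2 such that every leaf has degree 1, both hubs have degree c, and the two hubs are NOT adjacent in G equals the binomial coefficient C(2c, c). -/
open Classical

namespace SimpleGraph

variable {L : Type*}

/-- The graph joining the leaves in `s` to the hub `0` and all other leaves to the hub `1`. -/
def twoStar (s : Finset L) : SimpleGraph (L ⊕ Fin 2) where
  Adj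
    | .inl ℓ, .inr h => ℓ ∈ s ↔ h = 0
    | .inr h, .inl ℓ => ℓ ∈ s ↔ h = 0
    | _, _ => False
  symm := ⟨by rintro (a | a) (b | b) h <;> exact h⟩
  loopless := ⟨by rintro (a | a) h <;> exact h⟩

@[simp] theorem twoStar_adj_inl_inl (s : Finset L) (a b : L) :
    ¬ (twoStar s).Adj (.inl a) (.inl b) := id

@[simp] theorem twoStar_adj_inr_inr (s : Finset L) (a b : Fin 2) :
    ¬ (twoStar s).Adj (.inr a) (.inr b) := id

@[simp] theorem twoStar_adj_inl_inr (s : Finset L) (ℓ : L) (h : Fin 2) :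
    (twoStar s).Adj (.inl ℓ) (.inr h) ↔ (ℓ ∈ s ↔ h = 0) := Iff.rfl

@[simp] theorem twoStar_adj_inr_inl (s : Finset L) (ℓ : L) (h : Fin 2) :
    (twoStar s).Adj (.inr h) (.inl ℓ) ↔ (ℓ ∈ s ↔ h = 0) := Iff.rfl

theorem twoStar_injective : Function.Injective (twoStar (L := L)) := by
  intro s t hst
  ext ℓ
  have h : (twoStar s).Adj (.inl ℓ) (.inr 0) ↔ (twoStar t).Adj (.inl ℓ) (.inr 0) := by rw [hst]
  simpa using h

variable [Fintype L]

/-- The leaves adjacent to the hub `h`. -/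
noncomputable def hubLeaves (G : SimpleGraph (L ⊕ Fin 2)) (h : Fin 2) : Finset L :=
  {ℓ | G.Adj (.inr h) (.inl ℓ)}

@[simp] theorem mem_hubLeaves {G : SimpleGraph (L ⊕ Fin 2)} {h : Fin 2} {ℓ : L} :
    ℓ ∈ G.hubLeaves h ↔ G.Adj (.inr h) (.inl ℓ) := by
  simp [hubLeaves]

theorem degree_inr_eq_card_hubLeaves {G : SimpleGraph (L ⊕ Fin 2)}
    (hG : ¬ G.Adj (.inr 0) (.inr 1)) (h : Fin 2) :
    G.degree (.inr h) = (G.hubLeaves h).card := by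
  rw [← card_neighborFinset_eq_degree, ← (G.hubLeaves h).card_map .inl]
  congr 1
  have hG' : ¬ G.Adj (.inr 1) (.inr 0) := fun h => hG h.symm
  ext (ℓ | h')
  · simp
  · fin_cases h <;> fin_cases h' <;> simp [hG, hG']

theorem degree_twoStar_inl (s : Finset L) (ℓ : L) : (twoStar s).degree (.inl ℓ) = 1 := by
  rw [degree_eq_one_iff_existsUnique_adj]
  refine ⟨.inr (if ℓ ∈ s then 0 else 1), ?_, ?_⟩
  · by_cases hℓ : ℓ ∈ s <;> simp [hℓ]
  · rintro (a | h) hadj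
    · simp at hadj
    · by_cases hℓ : ℓ ∈ s <;> fin_cases h <;> simp_all

theorem hubLeaves_twoStar_zero (s : Finset L) : (twoStar s).hubLeaves 0 = s := by
  ext; simp

theorem hubLeaves_twoStar_one (s : Finset L) : (twoStar s).hubLeaves 1 = sᶜ := by
  ext; simp

/-- If all leaves have degree one and the hub degrees add up to the number of leaves, then
nonadjacent hubs force every leaf to be attached to a hub. -/
theorem twoStar_hubLeaves_zero {G : SimpleGraph (L ⊕ Fin 2)}
    (hleaf : ∀ ℓ : L, G.degree (.inl ℓ) = 1)
    (hsum : G.degree (.inr 0) + G.degree (.inr 1) = Fintype.card L)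
    (hG : ¬ G.Adj (.inr 0) (.inr 1)) : twoStar (G.hubLeaves 0) = G := by
  have huniq (ℓ : L) {x y} (hx : G.Adj (.inl ℓ) x) (hy : G.Adj (.inl ℓ) y) : x = y :=
    (degree_eq_one_iff_existsUnique_adj.mp (hleaf ℓ)).unique hx hy
  have hdisj : Disjoint (G.hubLeaves 0) (G.hubLeaves 1) := by
    rw [Finset.disjoint_left]
    intro ℓ h0 h1
    simpa using huniq ℓ (mem_hubLeaves.mp h0).symm (mem_hubLeaves.mp h1).symm
  have hunion : G.hubLeaves 0 ∪ G.hubLeaves 1 = Finset.univ := by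
    rw [← Finset.card_eq_iff_eq_univ, Finset.card_union_of_disjoint hdisj,
      ← degree_inr_eq_card_hubLeaves hG, ← degree_inr_eq_card_hubLeaves hG, hsum]
  have hcover (ℓ : L) : G.Adj (.inr 0) (.inl ℓ) ∨ G.Adj (.inr 1) (.inl ℓ) := by
    simpa using hunion.ge (Finset.mem_univ ℓ)
  have hhub (ℓ : L) (h : Fin 2) :
      G.Adj (.inr h) (.inl ℓ) ↔ (G.Adj (.inr 0) (.inl ℓ) ↔ h = 0) := by
    have hnot : ¬ (G.Adj (.inr 0) (.inl ℓ) ∧ G.Adj (.inr 1) (.inl ℓ)) := fun h => by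
      simpa using huniq ℓ h.1.symm h.2.symm
    have := hcover ℓ
    fin_cases h
    · simp
    · simp only [Fin.mk_one, one_ne_zero, iff_false]
      tauto
  ext (a | a) (b | b)
  · refine iff_of_false (twoStar_adj_inl_inl _ _ _) fun hab => ?_
    rcases hcover a with h | h <;> simpa using huniq a hab h.symm
  · rw [twoStar_adj_inl_inr, mem_hubLeaves, G.adj_comm (.inl a), hhub a b]
  · rw [twoStar_adj_inr_inl, mem_hubLeaves, hhub b a]
  · refine iff_of_false (twoStar_adj_inr_inr _ _ _) ?_
    have hG' : ¬ G.Adj (.inr 1) (.inr 0) := fun h => hG h.symm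
    fin_cases a <;> fin_cases b <;> simp [hG, hG']

end SimpleGraph

/-- For the multi-star degree sequence with two hubs of degree `c` and `2c` leaves of
degree `1`, the number of simple graphs in which the two hubs are not adjacent equals
the binomial coefficient `C(2c, c)`. -/
theorem card_two_star_hubs_nonadjacent (c : ℕ) (hc : 1 ≤ c) :
    Fintype.card {G : SimpleGraph (Fin (2 * c) ⊕ Fin 2) //
        (∀ ℓ : Fin (2 * c), G.degree (Sum.inl ℓ) = 1) ∧
        (∀ h : Fin 2, G.degree (Sum.inr h) = c) ∧
        ¬ G.Adj (Sum.inr 0) (Sum.inr 1)}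
      = Nat.choose (2 * c) c := by
  have hcard : Fintype.card (Fin (2 * c)) = 2 * c := Fintype.card_fin _
  conv_rhs => rw [← hcard, ← Fintype.card_finset_len]
  symm
  refine Fintype.card_of_bijective (f := fun s => ⟨SimpleGraph.twoStar s.1,
    SimpleGraph.degree_twoStar_inl s.1, fun h => ?_, SimpleGraph.twoStar_adj_inr_inr _ _ _⟩)
    ⟨fun s t hst => Subtype.ext (SimpleGraph.twoStar_injective (congrArg Subtype.val hst)), ?_⟩
  · rw [SimpleGraph.degree_inr_eq_card_hubLeaves (SimpleGraph.twoStar_adj_inr_inr _ _ _)]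
    have hs := s.2
    fin_cases h
    · simpa [SimpleGraph.hubLeaves_twoStar_zero] using hs
    · simp only [Fin.mk_one, SimpleGraph.hubLeaves_twoStar_one, Finset.card_compl, hcard]
      omega
  · rintro ⟨G, hleaf, hhub, hG⟩
    refine ⟨⟨G.hubLeaves 0, ?_⟩, Subtype.ext ?_⟩
    · rw [← SimpleGraph.degree_inr_eq_card_hubLeaves hG, hhub]
    · exact SimpleGraph.twoStar_hubLeaves_zero hleaf (by rw [hhub, hhub, hcard, two_mul]) hG
end

section
/- Let c ≥ 1. The number of simple graphs G on V = Fin (2c) ⊕ Fin 2 such that every leaf has degree 1, both hubs have degree c, and the two hubs ARE adjacent in G equals (2c)! / (2 · ((c−1)!)²), i.e., the multinomial coefficient C(2c; c−1, c−1, 2). -/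
open Classical

/-- The graph with two adjacent hubs in which the leaves in `A` hang off hub `0`, those in `B` hang
off hub `1`, and the remaining leaves are pairwise adjacent. -/
def twoHubGraph {α : Type*} (A B : Finset α) : SimpleGraph (α ⊕ Fin 2) where
  Adj
    | Sum.inl i, Sum.inl j => i ≠ j ∧ i ∉ A ∧ i ∉ B ∧ j ∉ A ∧ j ∉ B
    | Sum.inl i, Sum.inr h => i ∈ if h = 0 then A else B
    | Sum.inr h, Sum.inl i => i ∈ if h = 0 then A else B
    | Sum.inr h, Sum.inr k => h ≠ k
  symm := ⟨by
    rintro (i | h) (j | k) H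
    · exact ⟨H.1.symm, H.2.2.2.1, H.2.2.2.2, H.2.1, H.2.2.1⟩
    · exact H
    · exact H
    · exact Ne.symm H⟩
  loopless := ⟨by
    rintro (i | h) H
    · exact H.1 rfl
    · exact H rfl⟩

section

variable {α : Type*} {A B : Finset α}

@[simp] theorem twoHubGraph_adj_inl_inl {i j : α} :
    (twoHubGraph A B).Adj (Sum.inl i) (Sum.inl j) ↔
      i ≠ j ∧ i ∉ A ∧ i ∉ B ∧ j ∉ A ∧ j ∉ B := Iff.rfl

@[simp] theorem twoHubGraph_adj_inl_inr {i : α} {h : Fin 2} :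
    (twoHubGraph A B).Adj (Sum.inl i) (Sum.inr h) ↔ i ∈ if h = 0 then A else B := Iff.rfl

@[simp] theorem twoHubGraph_adj_inr_inl {i : α} {h : Fin 2} :
    (twoHubGraph A B).Adj (Sum.inr h) (Sum.inl i) ↔ i ∈ if h = 0 then A else B := Iff.rfl

@[simp] theorem twoHubGraph_adj_inr_inr {h k : Fin 2} :
    (twoHubGraph A B).Adj (Sum.inr h) (Sum.inr k) ↔ h ≠ k := Iff.rfl

theorem exists_other_of_card_eq_two {S : Finset α} (hS : S.card = 2) {i : α} (hi : i ∈ S) :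
    ∃ j ∈ S, i ≠ j ∧ ∀ k ∈ S, i ≠ k → k = j := by
  obtain ⟨x, y, hxy, rfl⟩ := Finset.card_eq_two.1 hS
  simp only [Finset.mem_insert, Finset.mem_singleton] at hi
  rcases hi with rfl | rfl
  · exact ⟨y, by simp, hxy, by grind⟩
  · exact ⟨x, by simp, hxy.symm, by grind⟩

variable [Fintype α]

/-- The leaves adjacent to hub `h`. -/
noncomputable def hubLeaves (G : SimpleGraph (α ⊕ Fin 2)) (h : Fin 2) : Finset α :=
  {i | G.Adj (Sum.inr h) (Sum.inl i)}

theorem mem_hubLeaves {G : SimpleGraph (α ⊕ Fin 2)} {h : Fin 2} {i : α} :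
    i ∈ hubLeaves G h ↔ G.Adj (Sum.inr h) (Sum.inl i) := by
  simp [hubLeaves]

theorem hubLeaves_twoHubGraph (h : Fin 2) :
    hubLeaves (twoHubGraph A B) h = if h = 0 then A else B := by
  ext i
  simp [mem_hubLeaves]

theorem degree_inr_eq_card_hubLeaves_add_one (G : SimpleGraph (α ⊕ Fin 2))
    (hG : G.Adj (Sum.inr 0) (Sum.inr 1)) (h : Fin 2) :
    G.degree (Sum.inr h) = (hubLeaves G h).card + 1 := by
  rw [← G.card_neighborFinset_eq_degree, G.neighborFinset_eq_filter, Finset.card_filter,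
    Fintype.sum_sum_type, Fin.sum_univ_two, hubLeaves, Finset.card_filter]
  fin_cases h <;> simp [hG, hG.symm]

theorem degree_twoHubGraph_inl (hAB : Disjoint A B) (hcard : (A ∪ B)ᶜ.card = 2) (i : α) :
    (twoHubGraph A B).degree (Sum.inl i) = 1 := by
  rw [SimpleGraph.degree_eq_one_iff_existsUnique_adj]
  by_cases hA : i ∈ A
  · have hB : i ∉ B := Finset.disjoint_left.1 hAB hA
    refine ⟨Sum.inr 0, by simpa using hA, ?_⟩
    rintro (j | k) H
    · simp [hA] at H
    · fin_cases k <;> simp_all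
  by_cases hB : i ∈ B
  · refine ⟨Sum.inr 1, by simpa using hB, ?_⟩
    rintro (j | k) H
    · simp [hB] at H
    · fin_cases k <;> simp_all
  obtain ⟨j, hj, hij, hu⟩ := exists_other_of_card_eq_two hcard (i := i) (by simp [hA, hB])
  simp only [Finset.mem_compl, Finset.mem_union, not_or] at hj hu
  refine ⟨Sum.inl j, ⟨hij, hA, hB, hj.1, hj.2⟩, ?_⟩
  rintro (k | k) H
  · rw [hu k ⟨H.2.2.2.1, H.2.2.2.2⟩ H.1]
  · fin_cases k <;> simp_all

theorem disjoint_hubLeaves {G : SimpleGraph (α ⊕ Fin 2)}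
    (hG : ∀ i, G.degree (Sum.inl i) = 1) : Disjoint (hubLeaves G 0) (hubLeaves G 1) := by
  rw [Finset.disjoint_left]
  intro i h0 h1
  obtain ⟨v, -, hv⟩ := G.degree_eq_one_iff_existsUnique_adj.1 (hG i)
  have := (hv _ (mem_hubLeaves.1 h0).symm).trans (hv _ (mem_hubLeaves.1 h1).symm).symm
  simp at this

theorem notMem_hubLeaves_of_adj_inl {G : SimpleGraph (α ⊕ Fin 2)}
    (hG : ∀ i, G.degree (Sum.inl i) = 1) {i j : α} (hij : G.Adj (Sum.inl i) (Sum.inl j))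
    (h : Fin 2) : i ∉ hubLeaves G h := by
  intro hi
  obtain ⟨v, -, hv⟩ := G.degree_eq_one_iff_existsUnique_adj.1 (hG i)
  have := (hv _ (mem_hubLeaves.1 hi).symm).trans (hv _ hij).symm
  simp at this

theorem twoHubGraph_hubLeaves {G : SimpleGraph (α ⊕ Fin 2)}
    (hG : ∀ i, G.degree (Sum.inl i) = 1) (hadj : G.Adj (Sum.inr 0) (Sum.inr 1))
    (hcard : (hubLeaves G 0 ∪ hubLeaves G 1)ᶜ.card = 2) :
    twoHubGraph (hubLeaves G 0) (hubLeaves G 1) = G := by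
  ext v w
  rcases v with i | h <;> rcases w with j | k
  · rw [twoHubGraph_adj_inl_inl]
    constructor
    · rintro ⟨hij, hi0, hi1, hj0, hj1⟩
      obtain ⟨m, -, -, hu⟩ := exists_other_of_card_eq_two hcard (i := i) (by simp [hi0, hi1])
      obtain ⟨v, hv, -⟩ := G.degree_eq_one_iff_existsUnique_adj.1 (hG i)
      rcases v with k | k
      · have hk := notMem_hubLeaves_of_adj_inl hG hv.symm
        have hik : i ≠ k := by
          rintro rfl
          exact G.loopless.irrefl _ hv
        rw [hu j (by simp [hj0, hj1]) hij, ← hu k (by simp [hk]) hik]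
        exact hv
      · fin_cases k
        · exact absurd (mem_hubLeaves.2 hv.symm) hi0
        · exact absurd (mem_hubLeaves.2 hv.symm) hi1
    · intro H
      have hi := notMem_hubLeaves_of_adj_inl hG H
      have hj := notMem_hubLeaves_of_adj_inl hG H.symm
      refine ⟨?_, hi 0, hi 1, hj 0, hj 1⟩
      rintro rfl
      exact G.loopless.irrefl _ H
  · rw [twoHubGraph_adj_inl_inr, G.adj_comm]
    fin_cases k <;> simp [mem_hubLeaves]
  · rw [twoHubGraph_adj_inr_inl]
    fin_cases h <;> simp [mem_hubLeaves]
  · rw [twoHubGraph_adj_inr_inr]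
    fin_cases h <;> fin_cases k <;> simp [hadj, hadj.symm]

theorem card_compl_union_eq_two {n : ℕ} (hα : Fintype.card α = 2 * (n + 1))
    (hA : A.card = n) (hB : B.card = n) (hAB : Disjoint A B) : (A ∪ B)ᶜ.card = 2 := by
  rw [Finset.card_compl, Finset.card_union_of_disjoint hAB]
  omega

/-- Graphs with two adjacent hubs of degree `n + 1` and `2 * (n + 1)` leaves correspond to pairs of
disjoint sets of `n` leaves. -/
noncomputable def adjacentHubsEquiv {n : ℕ} (hα : Fintype.card α = 2 * (n + 1)) :
    {G : SimpleGraph (α ⊕ Fin 2) //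
        (∀ i : α, G.degree (Sum.inl i) = 1) ∧
        (∀ h : Fin 2, G.degree (Sum.inr h) = n + 1) ∧
        G.Adj (Sum.inr 0) (Sum.inr 1)} ≃
      {p : (_ : Finset α) × Finset α //
        p ∈ (Finset.univ.powersetCard n).sigma fun A => Aᶜ.powersetCard n} where
  toFun G := ⟨⟨hubLeaves G.1 0, hubLeaves G.1 1⟩, by
    obtain ⟨G, hl, hh, hadj⟩ := G
    simp only [degree_inr_eq_card_hubLeaves_add_one G hadj, add_left_inj] at hh
    simp only [Finset.mem_sigma, Finset.mem_powersetCard, Finset.subset_univ, true_and, hh,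
      and_true, Finset.subset_compl_iff_disjoint_left]
    exact disjoint_hubLeaves hl⟩
  invFun p := ⟨twoHubGraph p.1.1 p.1.2, by
    obtain ⟨⟨A, B⟩, hp⟩ := p
    simp only [Finset.mem_sigma, Finset.mem_powersetCard, Finset.subset_univ, true_and,
      Finset.subset_compl_iff_disjoint_left] at hp
    obtain ⟨hA, hAB, hB⟩ := hp
    have hadj : (twoHubGraph A B).Adj (Sum.inr 0) (Sum.inr 1) := by simp
    refine ⟨degree_twoHubGraph_inl hAB (card_compl_union_eq_two hα hA hB hAB), fun h => ?_, hadj⟩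
    rw [degree_inr_eq_card_hubLeaves_add_one _ hadj, hubLeaves_twoHubGraph]
    split_ifs <;> simp [hA, hB]⟩
  left_inv := by
    rintro ⟨G, hl, hh, hadj⟩
    simp only [degree_inr_eq_card_hubLeaves_add_one G hadj, add_left_inj] at hh
    exact Subtype.ext (twoHubGraph_hubLeaves hl hadj
      (card_compl_union_eq_two hα (hh 0) (hh 1) (disjoint_hubLeaves hl)))
  right_inv := by
    rintro ⟨⟨A, B⟩, hp⟩
    simp [hubLeaves_twoHubGraph]

theorem card_sigma_powersetCard_compl (m n : ℕ) :
    ((Finset.univ.powersetCard m).sigma fun A : Finset α => Aᶜ.powersetCard n).card =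
      (Fintype.card α).choose m * (Fintype.card α - m).choose n := by
  rw [Finset.card_sigma, Finset.sum_congr rfl (g := fun _ => (Fintype.card α - m).choose n)]
  · simp
  · intro A hA
    rw [Finset.card_powersetCard, Finset.card_compl, (Finset.mem_powersetCard.1 hA).2]

end

theorem choose_mul_choose_eq_factorial_div (n : ℕ) :
    (2 * (n + 1)).choose n * (2 * (n + 1) - n).choose n =
      (2 * (n + 1)).factorial / (2 * n.factorial ^ 2) := by
  have hsub : 2 * (n + 1) - n = n + 2 := by omega
  have h1 := Nat.choose_mul_factorial_mul_factorial (n := 2 * (n + 1)) (k := n) (by omega)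
  have h2 := Nat.choose_mul_factorial_mul_factorial (n := n + 2) (k := n) (by omega)
  rw [hsub] at h1 ⊢
  rw [Nat.add_sub_cancel_left, Nat.factorial_two] at h2
  refine (Nat.div_eq_of_eq_mul_left (by positivity) ?_).symm
  rw [← h1, ← h2]
  ring

/-- For the multi-star degree sequence with two hubs of degree `c` and `2c` leaves of
degree `1`, the number of simple graphs in which the two hubs are adjacent equals
`(2c)! / (2 · ((c−1)!)²)`, the multinomial coefficient `C(2c; c−1, c−1, 2)`. -/
theorem card_two_star_hubs_adjacent (c : ℕ) (hc : 1 ≤ c) :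
    Fintype.card {G : SimpleGraph (Fin (2 * c) ⊕ Fin 2) //
        (∀ ℓ : Fin (2 * c), G.degree (Sum.inl ℓ) = 1) ∧
        (∀ h : Fin 2, G.degree (Sum.inr h) = c) ∧
        G.Adj (Sum.inr 0) (Sum.inr 1)}
      = (2 * c).factorial / (2 * ((c - 1).factorial) ^ 2) := by
  obtain ⟨n, rfl⟩ := Nat.exists_eq_add_of_le' hc
  have hcard := Fintype.card_congr (adjacentHubsEquiv (Fintype.card_fin (2 * (n + 1))))
  rw [Fintype.card_coe, card_sigma_powersetCard_compl, Fintype.card_fin,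
    choose_mul_choose_eq_factorial_div] at hcard
  rw [Nat.add_sub_cancel, ← hcard]
end

section
/- Let c ≥ 1, and among simple graphs on V = Fin (2c) ⊕ Fin 2 with every leaf of degree 1 and both hubs of degree c, let N_adj be the number of such graphs in which the two hubs are adjacent and N_non the number in which they are not adjacent. Then 2 · N_adj = c² · N_non; in particular, under the uniform distribution on all simple graphs with this degree sequence, the probability that the hubs are adjacent is c²/2 times the probability that they are not adjacent. -/
open Classical

/-- The leaves adjacent to the hub `h`. -/
noncomputable def leafNeighbors {α : Type*} [Fintype α] (G : SimpleGraph (α ⊕ Fin 2))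
    (h : Fin 2) : Finset α :=
  {x | G.Adj (Sum.inl x) (Sum.inr h)}

/-- The graph on leaves `α` and two hubs in which hub `h` is joined to the leaves in `S h`,
all leaves joined to no hub are joined to each other, and the hubs are adjacent iff `p`. -/
def hubGraph {α : Type*} (S : Fin 2 → Finset α) (p : Prop) : SimpleGraph (α ⊕ Fin 2) where
  Adj
    | Sum.inl x, Sum.inl y => x ≠ y ∧ (∀ h, x ∉ S h) ∧ ∀ h, y ∉ S h
    | Sum.inl x, Sum.inr h => x ∈ S h
    | Sum.inr h, Sum.inl x => x ∈ S h
    | Sum.inr h, Sum.inr k => h ≠ k ∧ p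
  symm := ⟨by
    rintro (x | h) (y | k) H
    · exact ⟨H.1.symm, H.2.2, H.2.1⟩
    · exact H
    · exact H
    · exact ⟨H.1.symm, H.2⟩⟩
  loopless := ⟨by
    rintro (x | h) H
    · exact H.1 rfl
    · exact H.1 rfl⟩

theorem leafNeighbors_hubGraph {α : Type*} [Fintype α] (S : Fin 2 → Finset α) (p : Prop) :
    leafNeighbors (hubGraph S p) = S := by
  ext h x
  simp [leafNeighbors, hubGraph]

theorem degree_hub {α : Type*} [Fintype α] (G : SimpleGraph (α ⊕ Fin 2)) (h : Fin 2) :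
    G.degree (Sum.inr h) = (leafNeighbors G h).card +
      if G.Adj (Sum.inr 0) (Sum.inr 1) then 1 else 0 := by
  rw [← SimpleGraph.card_neighborFinset_eq_degree, SimpleGraph.neighborFinset_eq_filter,
    Finset.card_filter, Fintype.sum_sum_type, leafNeighbors, Finset.card_filter,
    Fin.sum_univ_two]
  congr 1
  · simp only [G.adj_comm]
  · fin_cases h <;> simp [G.adj_comm (Sum.inr 1) (Sum.inr 0)]

theorem card_disjoint_pairs {α : Type*} [Fintype α] [DecidableEq α] (a : ℕ) :
    ((Finset.powersetCard a (Finset.univ : Finset α)).sigma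
      fun A => Finset.powersetCard a Aᶜ).card =
    (Fintype.card α).choose a * (Fintype.card α - a).choose a := by
  rw [Finset.card_sigma, Finset.sum_congr rfl (g := fun _ => (Fintype.card α - a).choose a)]
  · simp
  · intro A hA
    rw [Finset.card_powersetCard, Finset.card_compl, (Finset.mem_powersetCard.1 hA).2]

section Leaves

variable {α : Type*} [Fintype α] {G : SimpleGraph (α ⊕ Fin 2)}

theorem eq_of_adj_leaf (hG : ∀ x, G.degree (Sum.inl x) = 1) {x : α} {v w : α ⊕ Fin 2}
    (hv : G.Adj (Sum.inl x) v) (hw : G.Adj (Sum.inl x) w) : v = w :=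
  (SimpleGraph.degree_eq_one_iff_existsUnique_adj.1 (hG x)).unique hv hw

theorem disjoint_leafNeighbors (hG : ∀ x, G.degree (Sum.inl x) = 1) :
    Disjoint (leafNeighbors G 0) (leafNeighbors G 1) := by
  rw [Finset.disjoint_left]
  intro x h0 h1
  simp only [leafNeighbors, Finset.mem_filter_univ] at h0 h1
  simpa using eq_of_adj_leaf hG h0 h1

theorem card_free_leaves [DecidableEq α] {S : Fin 2 → Finset α} {a : ℕ} (hS : Disjoint (S 0) (S 1))
    (ha : ∀ h, (S h).card = a) :
    (Finset.univ.filter fun x => ∀ h, x ∉ S h).card + 2 * a = Fintype.card α := by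
  have : (Finset.univ.filter fun x => ∀ h, x ∉ S h) = (S 0 ∪ S 1)ᶜ := by
    ext x
    simp [Fin.forall_fin_two]
  rw [this, ← Finset.card_compl_add_card (S 0 ∪ S 1), Finset.card_union_of_disjoint hS, ha, ha,
    two_mul]

theorem hubGraph_leafNeighbors [DecidableEq α] (hG : ∀ x, G.degree (Sum.inl x) = 1)
    (hfree : (Finset.univ.filter fun x => ∀ h, x ∉ leafNeighbors G h).card ≤ 2) :
    hubGraph (leafNeighbors G) (G.Adj (Sum.inr 0) (Sum.inr 1)) = G := by
  have free_of_adj {x y : α} (hxy : G.Adj (Sum.inl x) (Sum.inl y)) :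
      ∀ h, x ∉ leafNeighbors G h := by
    intro h hx
    simp only [leafNeighbors, Finset.mem_filter_univ] at hx
    simpa using eq_of_adj_leaf hG hxy hx
  ext v w
  rcases v with x | h <;> rcases w with y | k
  · constructor
    · rintro ⟨hne, hx, hy⟩
      obtain ⟨z, hz, -⟩ := SimpleGraph.degree_eq_one_iff_existsUnique_adj.1 (hG x)
      rcases z with z | k
      · by_cases hzy : z = y
        · exact hzy ▸ hz
        have hxz : x ≠ z := fun e => hz.ne (congrArg _ e)
        have hsub : ({x, y, z} : Finset α) ⊆
            Finset.univ.filter fun x => ∀ h, x ∉ leafNeighbors G h := by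
          intro w hw
          simp only [Finset.mem_insert, Finset.mem_singleton] at hw
          rw [Finset.mem_filter_univ]
          rcases hw with rfl | rfl | rfl
          exacts [hx, hy, free_of_adj hz.symm]
        have := Finset.card_le_card hsub
        rw [Finset.card_eq_three.2 ⟨x, y, z, hne, hxz, Ne.symm hzy, rfl⟩] at this
        omega
      · exact absurd (by simpa [leafNeighbors] using hz) (hx k)
    · intro hxy
      exact ⟨fun e => hxy.ne (congrArg _ e), free_of_adj hxy, free_of_adj hxy.symm⟩
  · simp [hubGraph, leafNeighbors]
  · simp [hubGraph, leafNeighbors, G.adj_comm]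
  · fin_cases h <;> fin_cases k <;> simp [hubGraph, G.adj_comm (Sum.inr 1) (Sum.inr 0)]

theorem degree_leaf_hubGraph [DecidableEq α] {S : Fin 2 → Finset α} {p : Prop} (hS : Disjoint (S 0) (S 1))
    (hfree : (Finset.univ.filter fun x => ∀ h, x ∉ S h).card = 2 ∨
      (Finset.univ.filter fun x => ∀ h, x ∉ S h).card = 0) (x : α) :
    (hubGraph S p).degree (Sum.inl x) = 1 := by
  rw [SimpleGraph.degree_eq_one_iff_existsUnique_adj]
  by_cases hx : ∀ h, x ∉ S h
  · have hmem : x ∈ Finset.univ.filter fun x => ∀ h, x ∉ S h := by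
      rwa [Finset.mem_filter_univ]
    rcases hfree with hfree | hfree
    · have hcard := Finset.card_erase_of_mem hmem
      rw [hfree] at hcard
      obtain ⟨y, hy⟩ := Finset.card_eq_one.1 hcard
      have hiff (z : α) : (hubGraph S p).Adj (Sum.inl x) (Sum.inl z) ↔ z = y := by
        rw [← Finset.mem_singleton, ← hy, Finset.mem_erase, Finset.mem_filter_univ]
        exact ⟨fun H => ⟨H.1.symm, H.2.2⟩, fun H => ⟨H.1.symm, hx, H.2⟩⟩
      refine ⟨Sum.inl y, (hiff y).2 rfl, ?_⟩
      rintro (z | k) hz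
      · exact congrArg _ ((hiff z).1 hz)
      · exact absurd hz (hx k)
    · rw [Finset.card_eq_zero.1 hfree] at hmem
      simp at hmem
  · push Not at hx
    obtain ⟨h, hx⟩ := hx
    refine ⟨Sum.inr h, hx, ?_⟩
    rintro (y | k) hy
    · exact absurd hx (hy.2.1 h)
    · have hk : x ∈ S k := hy
      rw [Finset.disjoint_left] at hS
      fin_cases h <;> fin_cases k <;> simp_all

end Leaves

theorem card_graphs_two_hubs {c a : ℕ} {p : Prop} (hc : a + (if p then 1 else 0) = c) :
    Fintype.card {G : SimpleGraph (Fin (2 * c) ⊕ Fin 2) //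
        (∀ ℓ : Fin (2 * c), G.degree (Sum.inl ℓ) = 1) ∧
        (∀ h : Fin 2, G.degree (Sum.inr h) = c) ∧
        (G.Adj (Sum.inr 0) (Sum.inr 1) ↔ p)} =
      (2 * c).choose a * (2 * c - a).choose a := by
  have hcount := card_disjoint_pairs (α := Fin (2 * c)) a
  rw [Fintype.card_fin] at hcount
  rw [← hcount, Fintype.card_subtype]
  have hfree {S : Fin 2 → Finset (Fin (2 * c))} (hS : Disjoint (S 0) (S 1))
      (ha : ∀ h, (S h).card = a) :
      (Finset.univ.filter fun x => ∀ h, x ∉ S h).card = 2 ∨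
        (Finset.univ.filter fun x => ∀ h, x ∉ S h).card = 0 := by
    have := card_free_leaves hS ha
    rw [Fintype.card_fin] at this
    split_ifs at hc <;> omega
  have hcard {G : SimpleGraph (Fin (2 * c) ⊕ Fin 2)} (hdeg : ∀ h, G.degree (Sum.inr h) = c)
      (hp : G.Adj (Sum.inr 0) (Sum.inr 1) ↔ p) (h : Fin 2) : (leafNeighbors G h).card = a := by
    have := degree_hub G h
    simp only [hdeg, hp] at this
    omega
  refine Finset.card_nbij' (fun G => ⟨leafNeighbors G 0, leafNeighbors G 1⟩)
    (fun s => hubGraph ![s.1, s.2] p) ?_ ?_ ?_ ?_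
  · intro G hG
    obtain ⟨hl, hdeg, hp⟩ := by simpa only [Finset.coe_filter_univ, Set.mem_ofPred_eq] using hG
    have hd := disjoint_leafNeighbors hl
    simp only [Finset.coe_sigma, Set.mem_sigma_iff, Finset.mem_coe, Finset.mem_powersetCard]
    exact ⟨⟨Finset.subset_univ _, hcard hdeg hp 0⟩,
      Finset.subset_compl_comm.1 (Finset.subset_compl_iff_disjoint_right.2 hd), hcard hdeg hp 1⟩
  · rintro ⟨A, B⟩ hs
    simp only [Finset.coe_sigma, Set.mem_sigma_iff, Finset.mem_coe,
      Finset.mem_powersetCard] at hs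
    obtain ⟨⟨-, hA⟩, hAB, hB⟩ := hs
    have hS : Disjoint (![A, B] 0) (![A, B] 1) :=
      (Finset.subset_compl_iff_disjoint_right.1 hAB).symm
    have ha : ∀ h, (![A, B] h).card = a := Fin.forall_fin_two.2 ⟨hA, hB⟩
    have hp : (hubGraph ![A, B] p).Adj (Sum.inr 0) (Sum.inr 1) ↔ p := by simp [hubGraph]
    simp only [Finset.coe_filter_univ, Set.mem_ofPred_eq]
    refine ⟨degree_leaf_hubGraph hS (hfree hS ha), fun h => ?_, hp⟩
    rw [degree_hub, leafNeighbors_hubGraph, ha]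
    simpa only [hp] using hc
  · intro G hG
    obtain ⟨hl, hdeg, hp⟩ := by simpa only [Finset.coe_filter_univ, Set.mem_ofPred_eq] using hG
    have hS : ![leafNeighbors G 0, leafNeighbors G 1] = leafNeighbors G := by
      ext h : 1
      fin_cases h <;> rfl
    have hle := hfree (disjoint_leafNeighbors hl) (hcard hdeg hp)
    have := hubGraph_leafNeighbors hl (by omega)
    rw [propext hp] at this
    simpa only [hS] using this
  · rintro ⟨A, B⟩ -
    simp [leafNeighbors_hubGraph]

theorem two_mul_choose_mul_choose (a : ℕ) :
    2 * ((2 * (a + 1)).choose a * (2 * (a + 1) - a).choose a) =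
      (a + 1) ^ 2 * (2 * (a + 1)).choose (a + 1) := by
  have h1 := Nat.choose_succ_right_eq (2 * (a + 1)) a
  have h2 : (a + 2).choose a * 2 = (a + 2) * (a + 1) := by
    rw [Nat.choose_symm_add, Nat.choose_two_right]
    exact Nat.div_mul_cancel (by simpa [mul_comm] using (Nat.even_mul_succ_self (a + 1)).two_dvd)
  rw [show 2 * (a + 1) - a = a + 2 by omega] at h1 ⊢
  linear_combination (2 * (a + 1)).choose a * h2 - (a + 1) * h1

/-- Among simple graphs with the two-hub multi-star degree sequence (two hubs of degree
`c`, `2c` leaves of degree `1`), if `N_adj` counts those with the hubs adjacent and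
`N_non` those with the hubs non-adjacent, then `2 · N_adj = c² · N_non`: under the
uniform distribution the hubs are adjacent `c²/2` times as often as not. -/
theorem two_star_adjacency_ratio (c : ℕ) (hc : 1 ≤ c) :
    2 * Fintype.card {G : SimpleGraph (Fin (2 * c) ⊕ Fin 2) //
        (∀ ℓ : Fin (2 * c), G.degree (Sum.inl ℓ) = 1) ∧
        (∀ h : Fin 2, G.degree (Sum.inr h) = c) ∧
        G.Adj (Sum.inr 0) (Sum.inr 1)}
      = c ^ 2 * Fintype.card {G : SimpleGraph (Fin (2 * c) ⊕ Fin 2) //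
        (∀ ℓ : Fin (2 * c), G.degree (Sum.inl ℓ) = 1) ∧
        (∀ h : Fin 2, G.degree (Sum.inr h) = c) ∧
        ¬ G.Adj (Sum.inr 0) (Sum.inr 1)} := by
  obtain ⟨a, rfl⟩ := Nat.exists_eq_add_of_le' hc
  have hadj := card_graphs_two_hubs (c := a + 1) (a := a) (p := True) (by simp)
  have hnon := card_graphs_two_hubs (c := a + 1) (a := a + 1) (p := False) (by simp)
  simp only [iff_true] at hadj
  simp only [iff_false] at hnon
  rw [hadj, hnon, two_mul_choose_mul_choose, two_mul (a + 1), Nat.add_sub_cancel,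
    Nat.choose_self, mul_one]
end

section
/- Fix k ≥ 1 and hub degrees D : Fin k → ℕ, let L = Σ_i D i, and let H be a simple graph on Fin k with H.degree i ≤ D i for every i. Let e be the number of edges of H. Then N(H), the number of simple graphs G on V = Fin L ⊕ Fin k such that every leaf has degree 1, each hub inr i has degree D i, and for all i, j the hubs inr i and inr j are adjacent in G if and only if i and j are adjacent in H, satisfies N(H) = L! / ( (∏_i (D i − H.degree i)!) · 2^e · e! ). -/
open Classical

/-- `multiStarClassCard D H` is the number of simple graphs on `Fin (∑ i, D i) ⊕ Fin k`
in which every leaf `inl ℓ` has degree 1, every hub `inr i` has degree `D i`, and the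
hub-hub adjacency pattern is exactly `H`. -/
noncomputable def multiStarClassCard {k : ℕ} (D : Fin k → ℕ) (H : SimpleGraph (Fin k)) : ℕ :=
  Fintype.card {G : SimpleGraph (Fin (∑ i, D i) ⊕ Fin k) //
    (∀ ℓ : Fin (∑ i, D i), G.degree (Sum.inl ℓ) = 1) ∧
    (∀ i : Fin k, G.degree (Sum.inr i) = D i) ∧
    ∀ i j : Fin k, G.Adj (Sum.inr i) (Sum.inr j) ↔ H.Adj i j}

open Equiv in
/-- The number of functions `α → ι` whose fibre over each `i` has `n i` elements is the multinomial
coefficient `(card α)! / ∏ i, (n i)!`. -/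
theorem card_fiber_card_eq_mul_prod_factorial {α ι : Type*} [Finite α] [Fintype ι] (n : ι → ℕ)
    (h : Nat.card α = ∑ i, n i) :
    Nat.card {g : α → ι // ∀ i, Nat.card {a // g a = i} = n i} * ∏ i, (n i).factorial =
      (∑ i, n i).factorial := by
  let toEquiv : (Σ g : {g : α → ι // ∀ i, Nat.card {a // g a = i} = n i},
      ∀ i, {a // g.1 a = i} ≃ Fin (n i)) → (α ≃ Σ i, Fin (n i)) :=
    fun p ↦ (sigmaFiberEquiv p.1.1).symm.trans (sigmaCongrRight p.2)
  have toEquiv_apply (p) (a : α) : toEquiv p a = ⟨p.1.1 a, p.2 _ ⟨a, rfl⟩⟩ := rfl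
  have bij : Function.Bijective toEquiv := by
    constructor
    · rintro ⟨⟨g, hg⟩, u⟩ ⟨⟨g', hg'⟩, u'⟩ huu
      have key (a) : (⟨g a, u _ ⟨a, rfl⟩⟩ : Σ i, Fin (n i)) = ⟨g' a, u' _ ⟨a, rfl⟩⟩ := by
        rw [← toEquiv_apply ⟨⟨g, hg⟩, u⟩, ← toEquiv_apply ⟨⟨g', hg'⟩, u'⟩, huu]
      obtain rfl : g = g' := funext fun a ↦ congrArg Sigma.fst (key a)
      obtain rfl : u = u' := by
        ext i ⟨a, rfl⟩ : 3
        simpa using congrArg Fin.val (eq_of_heq (Sigma.mk.inj (key a)).2)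
      rfl
    · intro u
      let v (i : ι) : {a // (u a).1 = i} ≃ Fin (n i) :=
        (u.subtypeEquiv fun _ ↦ Iff.rfl).trans (Equiv.sigmaSubtype i)
      refine ⟨⟨⟨fun a ↦ (u a).1, fun i ↦ ?_⟩, v⟩, ?_⟩
      · simpa using Nat.card_congr (v i)
      · ext a : 1
        rfl
  have hα : Nat.card (α ≃ Σ i, Fin (n i)) = (∑ i, n i).factorial := by
    have e : α ≃ Σ i, Fin (n i) := (Finite.equivFinOfCardEq h).trans
      (Finite.equivFinOfCardEq (by simp)).symm
    rw [← Nat.card_congr (e.symm.equivCongr (Equiv.refl _)), Nat.card_perm]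
    simp
  have := Fintype.ofFinite {g : α → ι // ∀ i, Nat.card {a // g a = i} = n i}
  rw [← hα, ← Nat.card_congr (Equiv.ofBijective _ bij), Nat.card_sigma]
  have hfib (g : {g : α → ι // ∀ i, Nat.card {a // g a = i} = n i}) :
      Nat.card (∀ i, {a // g.1 a = i} ≃ Fin (n i)) = ∏ i, (n i).factorial := by
    rw [Nat.card_pi]
    refine Finset.prod_congr rfl fun i _ ↦ ?_
    have e : {a // g.1 a = i} ≃ Fin (n i) := Finite.equivFinOfCardEq (g.2 i)
    rw [Nat.card_congr (e.equivCongr (Equiv.refl _)), Nat.card_perm, Nat.card_fin]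
  simp [hfib]

/-- The number of involutions of `α` with `m` fixed points and `e` two-cycles is
`(card α)! / (m! * 2 ^ e * e!)`. -/
theorem card_cycleType_replicate_two_mul (α : Type*) [Fintype α] [DecidableEq α] (e m : ℕ)
    (h : Fintype.card α = m + 2 * e) :
    Nat.card {σ : Equiv.Perm α // σ.cycleType = Multiset.replicate e 2} *
      (m.factorial * 2 ^ e * e.factorial) = (m + 2 * e).factorial := by
  have key := Equiv.Perm.card_of_cycleType_mul_eq α (Multiset.replicate e 2)
  have hprod : ∏ c ∈ (Multiset.replicate e 2).toFinset,
      ((Multiset.replicate e 2).count c).factorial = e.factorial := by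
    rcases eq_or_ne e 0 with rfl | he
    · simp
    · simp [Multiset.toFinset_replicate, he]
  have hm : m + 2 * e - e * 2 = m := by omega
  have hle : e * 2 ≤ m + 2 * e := by omega
  rw [hprod, h, if_pos ⟨by simpa using hle, fun a ha ↦ (Multiset.eq_of_mem_replicate ha).ge⟩] at key
  simpa [hm, Nat.card_eq_fintype_card, Fintype.card_subtype] using key

namespace SimpleGraph

variable {V ι : Type*}

/-- The graph on `V ⊕ ι` in which an involution `σ` pairs the non-fixed vertices of `V`, each fixed
point `a` of `σ` is joined to `g a : ι`, and `ι` carries the graph `H`. -/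
def multiStar (H : SimpleGraph ι) (σ : Equiv.Perm V) (hσ : Function.Involutive σ)
    (g : {a // σ a = a} → ι) : SimpleGraph (V ⊕ ι) where
  Adj
    | .inl a, .inl b => σ a = b ∧ a ≠ b
    | .inl a, .inr i => ∃ h : σ a = a, g ⟨a, h⟩ = i
    | .inr i, .inl a => ∃ h : σ a = a, g ⟨a, h⟩ = i
    | .inr i, .inr j => H.Adj i j
  symm := ⟨by
    rintro (a | i) (b | j) h
    · exact ⟨h.1 ▸ hσ a, h.2.symm⟩
    · exact h
    · exact h
    · exact H.adj_symm h⟩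
  loopless := ⟨by
    rintro (a | i) h
    · exact h.2 rfl
    · exact H.irrefl h⟩

section multiStar

variable (H : SimpleGraph ι) (σ : Equiv.Perm V) (hσ : Function.Involutive σ)
  (g : {a // σ a = a} → ι)

@[simp]
theorem multiStar_adj_inl_inl (a b : V) :
    (multiStar H σ hσ g).Adj (.inl a) (.inl b) ↔ σ a = b ∧ a ≠ b := Iff.rfl

@[simp]
theorem multiStar_adj_inl_inr (a : V) (i : ι) :
    (multiStar H σ hσ g).Adj (.inl a) (.inr i) ↔ ∃ h : σ a = a, g ⟨a, h⟩ = i := Iff.rfl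

@[simp]
theorem multiStar_adj_inr_inr (i j : ι) :
    (multiStar H σ hσ g).Adj (.inr i) (.inr j) ↔ H.Adj i j := Iff.rfl

theorem multiStar_existsUnique_adj_inl (a : V) :
    ∃! y, (multiStar H σ hσ g).Adj (.inl a) y := by
  by_cases h : σ a = a
  · refine ⟨.inr (g ⟨a, h⟩), ⟨h, rfl⟩, ?_⟩
    rintro (b | i) hy
    · exact absurd (h.symm.trans hy.1) hy.2
    · obtain ⟨_, rfl⟩ := hy
      rfl
  · refine ⟨.inl (σ a), ⟨rfl, Ne.symm h⟩, ?_⟩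
    rintro (b | i) hy
    · rw [hy.1]
    · exact absurd hy.1 h

theorem card_multiStar_adj_inr (i : ι) :
    Nat.card {a // (multiStar H σ hσ g).Adj (.inl a) (.inr i)} = Nat.card {x // g x = i} :=
  (Nat.card_congr (Equiv.subtypeSubtypeEquivSubtypeExists _ (g · = i))).symm

variable {H σ g} {hσ}

theorem multiStar_injective {σ' : Equiv.Perm V} {hσ' : Function.Involutive σ'}
    {g' : {a // σ' a = a} → ι} (h : multiStar H σ hσ g = multiStar H σ' hσ' g') :
    ∃ h : σ = σ', ∀ a (ha : σ a = a), g ⟨a, ha⟩ = g' ⟨a, h ▸ ha⟩ := by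
  have key (a b : V) : σ a = b ∧ a ≠ b ↔ σ' a = b ∧ a ≠ b := by
    rw [← multiStar_adj_inl_inl H σ hσ g, h, multiStar_adj_inl_inl]
  obtain rfl : σ = σ' := by
    ext a
    by_cases ha : σ a = a
    · by_contra hne
      exact hne ((key a _).2 ⟨rfl, fun h' ↦ hne (ha.trans h')⟩).1
    · exact ((key a _).1 ⟨rfl, Ne.symm ha⟩).1.symm
  refine ⟨rfl, fun a ha ↦ ?_⟩
  have := (multiStar_adj_inl_inr H σ hσ g a (g ⟨a, ha⟩)).2 ⟨ha, rfl⟩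
  rw [h] at this
  obtain ⟨_, h'⟩ := this
  exact h'.symm

theorem exists_eq_multiStar {G : SimpleGraph (V ⊕ ι)} (hG : ∀ a, ∃! y, G.Adj (.inl a) y)
    (hH : ∀ i j, G.Adj (.inr i) (.inr j) ↔ H.Adj i j) :
    ∃ (σ : Equiv.Perm V) (hσ : Function.Involutive σ) (g : {a // σ a = a} → ι),
      multiStar H σ hσ g = G := by
  choose f hf hf' using hG
  have adj_iff (a y) : G.Adj (.inl a) y ↔ f a = y := ⟨fun h ↦ (hf' a y h).symm, fun h ↦ h ▸ hf a⟩
  have symm_f {a b} (h : f a = .inl b) : f b = .inl a := by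
    rw [← adj_iff] at h ⊢
    exact h.symm
  have ne_f (a) : f a ≠ .inl a := fun h ↦ G.irrefl ((adj_iff _ _).2 h)
  let s (a : V) : V := Sum.elim id (fun _ ↦ a) (f a)
  have s_inl {a b} (h : f a = .inl b) : s a = b := by simp [s, h]
  have s_inr {a i} (h : f a = .inr i) : s a = a := by simp [s, h]
  have hs : Function.Involutive s := fun a ↦ by
    rcases h : f a with b | i
    · rw [s_inl h, s_inl (symm_f h)]
    · rw [s_inr h, s_inr h]
  have hfix (a) (h : s a = a) : ∃ i, f a = .inr i := by
    rcases h' : f a with b | i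
    · exact absurd (by rwa [← s_inl h', h] at h') (ne_f a)
    · exact ⟨i, rfl⟩
  choose g hg using hfix
  refine ⟨hs.toPerm, hs, fun a ↦ g a.1 a.2, ?_⟩
  have inl_inr (a : V) (i : ι) : (∃ h : s a = a, g a h = i) ↔ G.Adj (.inl a) (.inr i) := by
    rw [adj_iff]
    refine ⟨fun ⟨h, h'⟩ ↦ h' ▸ hg a h, fun h ↦ ⟨s_inr h, ?_⟩⟩
    simpa [h] using (hg a (s_inr h)).symm
  ext (a | i) (b | j)
  · rw [adj_iff]
    change s a = b ∧ a ≠ b ↔ _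
    refine ⟨fun ⟨h, hne⟩ ↦ ?_, fun h ↦ ⟨s_inl h, fun hab ↦ ne_f a (hab ▸ h)⟩⟩
    rcases h' : f a with c | i
    · rw [← h, s_inl h']
    · exact absurd ((s_inr h').symm.trans h) hne
  · exact inl_inr a j
  · exact (inl_inr b i).trans (G.adj_comm _ _)
  · exact (hH i j).symm

end multiStar

theorem cycleType_eq_replicate_two_of_involutive [Fintype V] [DecidableEq V]
    {σ : Equiv.Perm V} (hσ : Function.Involutive σ) {e : ℕ}
    (h : Fintype.card V = Nat.card {a // σ a = a} + 2 * e) :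
    σ.cycleType = Multiset.replicate e 2 := by
  have h2 : σ ^ 2 = 1 := by
    ext a
    simpa [pow_two] using hσ a
  have hrep := Multiset.eq_replicate_card.2 (Equiv.Perm.pow_prime_eq_one_iff.1 h2)
  have hfix := σ.card_fixedPoints
  have hle := σ.sum_cycleType_le
  rw [← Nat.card_eq_fintype_card] at hfix
  change Nat.card {a // σ a = a} = _ at hfix
  have hsum : σ.cycleType.sum = σ.cycleType.card * 2 := by
    conv_lhs => rw [hrep]
    simp
  rw [hrep]
  congr 1
  omega

theorem involutive_of_cycleType_eq_replicate_two [Fintype V] [DecidableEq V]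
    {σ : Equiv.Perm V} {e : ℕ} (h : σ.cycleType = Multiset.replicate e 2) :
    Function.Involutive σ := by
  have h2 : σ ^ 2 = 1 := Equiv.Perm.pow_prime_eq_one_iff.2 fun c hc ↦
    Multiset.eq_of_mem_replicate (h ▸ hc)
  intro a
  simpa [pow_two] using congrArg (· a) h2

theorem card_existsUnique_adj_inl_mul [Finite V] [Fintype ι] (H : SimpleGraph ι) (n : ι → ℕ)
    (e : ℕ) (hV : Nat.card V = ∑ i, n i + 2 * e) :
    Nat.card {G : SimpleGraph (V ⊕ ι) // (∀ a, ∃! y, G.Adj (.inl a) y) ∧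
        (∀ i, Nat.card {a // G.Adj (.inl a) (.inr i)} = n i) ∧
        ∀ i j, G.Adj (.inr i) (.inr j) ↔ H.Adj i j} *
      ((∏ i, (n i).factorial) * 2 ^ e * e.factorial) = (Nat.card V).factorial := by
  classical
  have := Fintype.ofFinite V
  let toGraph : (Σ σ : {σ : Equiv.Perm V // σ.cycleType = Multiset.replicate e 2},
        {g : {a // σ.1 a = a} → ι // ∀ i, Nat.card {x // g x = i} = n i}) →
      {G : SimpleGraph (V ⊕ ι) // (∀ a, ∃! y, G.Adj (.inl a) y) ∧
        (∀ i, Nat.card {a // G.Adj (.inl a) (.inr i)} = n i) ∧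
        ∀ i j, G.Adj (.inr i) (.inr j) ↔ H.Adj i j} := fun p ↦
    ⟨multiStar H p.1.1 (involutive_of_cycleType_eq_replicate_two p.1.2) p.2.1,
      multiStar_existsUnique_adj_inl _ _ _ _,
      fun i ↦ (card_multiStar_adj_inr _ _ _ _ i).trans (p.2.2 i), fun _ _ ↦ Iff.rfl⟩
  have bij : Function.Bijective toGraph := by
    constructor
    · rintro ⟨⟨σ, hσ⟩, g, hg⟩ ⟨⟨σ', hσ'⟩, g', hg'⟩ h
      obtain ⟨hσσ', h'⟩ := multiStar_injective
        (hσ := involutive_of_cycleType_eq_replicate_two hσ)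
        (hσ' := involutive_of_cycleType_eq_replicate_two hσ')
        (congrArg Subtype.val h)
      subst hσσ'
      obtain rfl : g = g' := funext fun a ↦ h' a.1 a.2
      rfl
    · rintro ⟨G, hG, hn, hH⟩
      obtain ⟨σ, hσ, g, rfl⟩ := exists_eq_multiStar hG hH
      have hg (i) : Nat.card {x // g x = i} = n i :=
        (card_multiStar_adj_inr _ _ _ _ i).symm.trans (hn i)
      have hfix : Nat.card {a // σ a = a} = ∑ i, n i := by
        rw [← Nat.card_congr (Equiv.sigmaFiberEquiv g), Nat.card_sigma]
        exact Finset.sum_congr rfl fun i _ ↦ hg i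
      have hcyc : σ.cycleType = Multiset.replicate e 2 :=
        cycleType_eq_replicate_two_of_involutive hσ (by rw [hfix, ← hV, Nat.card_eq_fintype_card])
      exact ⟨⟨⟨σ, hcyc⟩, g, hg⟩, rfl⟩
  have hfix (σ : {σ : Equiv.Perm V // σ.cycleType = Multiset.replicate e 2}) :
      Nat.card {a // σ.1 a = a} = ∑ i, n i := by
    have h := σ.1.card_fixedPoints
    rw [← Nat.card_eq_fintype_card, ← Nat.card_eq_fintype_card, σ.2, hV] at h
    refine h.trans ?_
    simp [mul_comm]
  have hM := fun σ ↦ card_fiber_card_eq_mul_prod_factorial n (hfix σ)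
  rw [← Nat.card_congr (Equiv.ofBijective _ bij), Nat.card_sigma, mul_assoc, ← mul_assoc,
    Finset.sum_mul, Finset.sum_congr rfl fun σ _ ↦ hM σ, hV,
    ← card_cycleType_replicate_two_mul V e _ (Nat.card_eq_fintype_card.symm.trans hV)]
  simp [mul_assoc]

theorem degree_inr_eq_card_add_degree [Finite V] {G : SimpleGraph (V ⊕ ι)} {H : SimpleGraph ι}
    (hH : ∀ i j, G.Adj (.inr i) (.inr j) ↔ H.Adj i j) (i : ι)
    [Fintype (G.neighborSet (.inr i))] [Fintype (H.neighborSet i)] :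
    G.degree (.inr i) = Nat.card {a // G.Adj (.inl a) (.inr i)} + H.degree i := by
  have e : G.neighborSet (.inr i) ≃ {a // G.Adj (.inl a) (.inr i)} ⊕ H.neighborSet i :=
    Equiv.subtypeSum.trans (Equiv.sumCongr (Equiv.subtypeEquivRight fun _ ↦ G.adj_comm _ _)
      (Equiv.subtypeEquivRight fun j ↦ hH i j))
  rw [← card_neighborSet_eq_degree, ← card_neighborSet_eq_degree, ← Nat.card_eq_fintype_card,
    ← Nat.card_eq_fintype_card, Nat.card_congr e, Nat.card_sum]

end SimpleGraph

/-- The size of the equivalence class of multi-star graphs with hub-hub adjacency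
pattern `H` is `L! / ((∏ i, (D i − c_i)!) · 2^e · e!)`, where `L = ∑ i, D i`,
`c_i = H.degree i` and `e` is the number of edges of `H`. -/
theorem multiStarClassCard_eq {k : ℕ} (hk : 1 ≤ k) (D : Fin k → ℕ)
    (H : SimpleGraph (Fin k)) (hdeg : ∀ i, H.degree i ≤ D i) :
    multiStarClassCard D H
      = (∑ i, D i).factorial /
          ((∏ i, (D i - H.degree i).factorial)
            * 2 ^ H.edgeFinset.card * (H.edgeFinset.card).factorial) := by
  have hL : Nat.card (Fin (∑ i, D i)) =
      ∑ i, (D i - H.degree i) + 2 * H.edgeFinset.card := by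
    rw [← H.sum_degrees_eq_twice_card_edges, ← Finset.sum_add_distrib, Nat.card_fin]
    exact Finset.sum_congr rfl fun i _ ↦ (Nat.sub_add_cancel (hdeg i)).symm
  have key := SimpleGraph.card_existsUnique_adj_inl_mul H (fun i ↦ D i - H.degree i) _ hL
  rw [Nat.card_fin] at key
  refine (Nat.div_eq_of_eq_mul_left (by positivity) ?_).symm
  rw [← key, multiStarClassCard, ← Nat.card_eq_fintype_card]
  congr 1
  refine (Nat.card_congr (Equiv.subtypeEquivRight fun G ↦ ?_)).symm
  simp only [SimpleGraph.degree_eq_one_iff_existsUnique_adj]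
  refine and_congr_right fun _ ↦ and_congr_left fun hH ↦ forall_congr' fun i ↦ ?_
  rw [SimpleGraph.degree_inr_eq_card_add_degree hH i]
  have := hdeg i
  omega
end

section
/- Fix k ≥ 1 and hub degrees D : Fin k → ℕ, let L = Σ_i D i, and let H be a simple graph on Fin k with H.degree i ≤ D i for every i. Suppose i ≠ j are adjacent in H, and let H' be H with the edge {i, j} removed. Let c_i = H.degree i, c_j = H.degree j, and s = Σ_t H.degree t. Then removing the edge {i, j} changes the class size by the factor (D i − c_i + 1)(D j − c_j + 1)/s; precisely, N(H) · s = N(H') · (D i − c_i + 1) · (D j − c_j + 1). -/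
open Classical

namespace SimpleGraph

variable {V : Type*}

/-- The closed walk `a b c d a`, as a graph. -/
def fourCycle (a b c d : V) : SimpleGraph V :=
  fromEdgeSet {s(a, b), s(b, c), s(c, d), s(d, a)}

theorem fourCycle_rotate (a b c d : V) : fourCycle b c d a = fourCycle a b c d := by
  unfold fourCycle
  congr 1
  ext e
  simp only [Set.mem_insert_iff, Set.mem_singleton_iff]
  tauto

theorem symmDiff_adj (G C : SimpleGraph V) (x y : V) :
    (symmDiff G C).Adj x y ↔ (G.Adj x y ∧ ¬ C.Adj x y) ∨ (C.Adj x y ∧ ¬ G.Adj x y) := by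
  simp [symmDiff_def]

theorem degree_eq_card_filter [Fintype V] (G : SimpleGraph V) (v : V)
    [Fintype (G.neighborSet v)] :
    G.degree v = (Finset.univ.filter (G.Adj v)).card := by
  rw [← card_neighborFinset_eq_degree]
  congr 1
  ext w
  simp

/-- Exchanging one neighbour for a non-neighbour at `v` preserves the degree of `v`. -/
theorem degree_symmDiff_of_adj_iff [Fintype V] {G C : SimpleGraph V} {v x y : V}
    (hC : ∀ w, C.Adj v w ↔ w = x ∨ w = y) (hx : G.Adj v x) (hy : ¬ G.Adj v y) :
    (symmDiff G C).degree v = G.degree v := by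
  have h : Finset.univ.filter ((symmDiff G C).Adj v)
      = insert y ((Finset.univ.filter (G.Adj v)).erase x) := by
    ext w
    simp only [symmDiff_adj, hC, Finset.mem_filter, Finset.mem_univ, true_and,
      Finset.mem_insert, Finset.mem_erase]
    grind
  rw [degree_eq_card_filter, degree_eq_card_filter, h, Finset.card_insert_of_notMem (by simp [hy]),
    Finset.card_erase_add_one (by simp [hx])]

/-- Switching along an alternating four-cycle preserves all degrees. -/
theorem degree_symmDiff_fourCycle [Fintype V] {G : SimpleGraph V} {a b c d : V}
    (hac : a ≠ c) (hbd : b ≠ d) (hbc : b ≠ c) (hda : d ≠ a)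
    (hab : G.Adj a b) (hcd : G.Adj c d) (hnbc : ¬ G.Adj b c) (hnda : ¬ G.Adj d a) (v : V) :
    (symmDiff G (fourCycle a b c d)).degree v = G.degree v := by
  have hne₁ := hab.ne
  have hne₂ := hcd.ne
  have hadj (v w : V) : (fourCycle a b c d).Adj v w ↔
      (s(v, w) = s(a, b) ∨ s(v, w) = s(b, c) ∨ s(v, w) = s(c, d) ∨ s(v, w) = s(d, a)) ∧ v ≠ w := by
    simp [fourCycle]
  simp only [Sym2.eq_iff] at hadj
  by_cases ha : v = a
  · subst ha
    exact degree_symmDiff_of_adj_iff (x := b) (y := d) (by grind) hab (fun h => hnda h.symm)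
  by_cases hb : v = b
  · subst hb
    exact degree_symmDiff_of_adj_iff (x := a) (y := c) (by grind) hab.symm hnbc
  by_cases hc : v = c
  · subst hc
    exact degree_symmDiff_of_adj_iff (x := d) (y := b) (by grind) hcd (fun h => hnbc h.symm)
  by_cases hd : v = d
  · subst hd
    exact degree_symmDiff_of_adj_iff (x := c) (y := a) (by grind) hcd.symm hnda
  have h : Finset.univ.filter ((symmDiff G (fourCycle a b c d)).Adj v)
      = Finset.univ.filter (G.Adj v) := by
    ext w
    simp only [symmDiff_adj, hadj, Finset.mem_filter, Finset.mem_univ, true_and]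
    grind
  rw [degree_eq_card_filter, degree_eq_card_filter, h]

theorem degree_sum_eq {α β : Type*} [Fintype α] [Fintype β] (G : SimpleGraph (α ⊕ β)) (v : α ⊕ β) :
    G.degree v = (Finset.univ.filter fun x => G.Adj v (.inl x)).card
      + (Finset.univ.filter fun y => G.Adj v (.inr y)).card := by
  rw [degree_eq_card_filter]
  simp only [Finset.card_filter, Fintype.sum_sum_type]

theorem degree_deleteEdges_add_one [Fintype V] {G : SimpleGraph V} {u v : V}
    [Fintype ((G.deleteEdges {s(u, v)}).neighborSet u)] (h : G.Adj u v) :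
    (G.deleteEdges {s(u, v)}).degree u + 1 = G.degree u := by
  have : Finset.univ.filter ((G.deleteEdges {s(u, v)}).Adj u)
      = (Finset.univ.filter (G.Adj u)).erase v := by
    ext w
    simp only [deleteEdges_adj, Set.mem_singleton_iff, Sym2.eq_iff, Finset.mem_filter,
      Finset.mem_univ, true_and, Finset.mem_erase]
    grind
  rw [degree_eq_card_filter G, ← Finset.card_erase_add_one (a := v) (by simp [h]), ← this,
    degree_eq_card_filter]
  congr!

end SimpleGraph

open SimpleGraph

/-- `G` is a multi-star graph with hub degrees `D` and hub-hub adjacency pattern `H`. -/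
def IsMultiStar {k : ℕ} (D : Fin k → ℕ) (H : SimpleGraph (Fin k))
    (G : SimpleGraph (Fin (∑ i, D i) ⊕ Fin k)) : Prop :=
  (∀ ℓ : Fin (∑ i, D i), G.degree (Sum.inl ℓ) = 1) ∧
    (∀ i : Fin k, G.degree (Sum.inr i) = D i) ∧
    ∀ i j : Fin k, G.Adj (Sum.inr i) (Sum.inr j) ↔ H.Adj i j

theorem multiStarClassCard_eq_card_filter {k : ℕ} (D : Fin k → ℕ) (H : SimpleGraph (Fin k)) :
    multiStarClassCard D H = (Finset.univ.filter (IsMultiStar D H)).card := by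
  unfold multiStarClassCard IsMultiStar
  rw [Fintype.card_subtype]
  congr!

namespace IsMultiStar

variable {k : ℕ} {D : Fin k → ℕ} {H : SimpleGraph (Fin k)}
  {G : SimpleGraph (Fin (∑ i, D i) ⊕ Fin k)}

theorem card_leaves_add_degree (h : IsMultiStar D H G) (i : Fin k)
    [Fintype (H.neighborSet i)] :
    (Finset.univ.filter fun ℓ => G.Adj (.inr i) (.inl ℓ)).card + H.degree i = D i := by
  rw [← h.2.1 i, degree_sum_eq, degree_eq_card_filter H]
  simp only [h.2.2]

/-- The number of ordered pairs of adjacent leaves is the sum of the hub-hub degrees. -/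
theorem card_adj_leaves (h : IsMultiStar D H G) :
    (Finset.univ.filter fun p : Fin (∑ i, D i) × Fin (∑ i, D i) =>
      G.Adj (.inl p.1) (.inl p.2)).card = ∑ t, H.degree t := by
  have h₁ : ∑ ℓ, G.degree (.inl ℓ) = ∑ t, D t := by simp [h.1]
  have h₂ := Finset.sum_congr rfl fun t (_ : t ∈ Finset.univ) => h.card_leaves_add_degree t
  simp only [degree_sum_eq G, Finset.sum_add_distrib] at h₁ h₂
  have h₃ : ∑ ℓ, (Finset.univ.filter fun t => G.Adj (.inl ℓ) (.inr t)).card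
      = ∑ t, (Finset.univ.filter fun ℓ => G.Adj (.inr t) (.inl ℓ)).card := by
    simp only [Finset.card_filter]
    rw [Finset.sum_comm]
    simp only [G.adj_comm]
  have h₄ : (Finset.univ.filter fun p : Fin (∑ i, D i) × Fin (∑ i, D i) =>
      G.Adj (.inl p.1) (.inl p.2)).card
      = ∑ ℓ, (Finset.univ.filter fun ℓ' => G.Adj (.inl ℓ) (.inl ℓ')).card := by
    simp only [Finset.card_filter, Fintype.sum_prod_type]
  linarith

/-- A leaf has only one neighbour. -/
theorem eq_of_adj (h : IsMultiStar D H G) {ℓ : Fin (∑ i, D i)} {x y}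
    (hx : G.Adj (.inl ℓ) x) (hy : G.Adj (.inl ℓ) y) : x = y := by
  have h₁ := h.1 ℓ
  rw [degree_eq_card_filter] at h₁
  exact Finset.card_le_one.mp h₁.le x (by simp [hx]) y (by simp [hy])

variable {i j : Fin k} {ℓ ℓ' : Fin (∑ i, D i)}

theorem switch_deleteEdges (h : IsMultiStar D H G) (hij : H.Adj i j)
    (hℓ : G.Adj (.inl ℓ) (.inl ℓ')) :
    IsMultiStar D (H.deleteEdges {s(i, j)})
      (symmDiff G (fourCycle (.inr i) (.inr j) (.inl ℓ') (.inl ℓ))) := by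
  have hdeg := degree_symmDiff_fourCycle (G := G) (a := .inr i) (b := .inr j) (c := .inl ℓ')
    (d := .inl ℓ) (by simp) (by simp) (by simp) (by simp) ((h.2.2 i j).2 hij) hℓ.symm
    (fun hj => by simpa using h.eq_of_adj hj.symm hℓ.symm)
    (fun hi => by simpa using h.eq_of_adj hi hℓ)
  refine ⟨fun m => (hdeg _).trans (h.1 m), fun t => (hdeg _).trans (h.2.1 t), fun t u => ?_⟩
  simp only [symmDiff_adj, h.2.2, fourCycle, fromEdgeSet_adj, deleteEdges_adj,
    Set.mem_insert_iff, Set.mem_singleton_iff, Sym2.eq_iff, Sum.inr.injEq, reduceCtorEq, ne_eq]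
  have := hij.symm
  have := hij.ne
  grind

theorem switch_of_deleteEdges (h : IsMultiStar D (H.deleteEdges {s(i, j)}) G) (hij : H.Adj i j)
    (hi : G.Adj (.inr i) (.inl ℓ)) (hj : G.Adj (.inr j) (.inl ℓ')) :
    IsMultiStar D H (symmDiff G (fourCycle (.inr i) (.inr j) (.inl ℓ') (.inl ℓ))) := by
  have hdeg := degree_symmDiff_fourCycle (G := G) (a := .inr j) (b := .inl ℓ') (c := .inl ℓ)
    (d := .inr i) (by simp) (by simp)
    (fun he => hij.ne (Sum.inr_injective (h.eq_of_adj hi.symm (he ▸ hj.symm))))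
    (by simpa using hij.ne) hj hi.symm
    (fun hℓ => by simpa using h.eq_of_adj hℓ hj.symm)
    (by simp [h.2.2])
  rw [fourCycle_rotate] at hdeg
  refine ⟨fun m => (hdeg _).trans (h.1 m), fun t => (hdeg _).trans (h.2.1 t), fun t u => ?_⟩
  simp only [symmDiff_adj, h.2.2, fourCycle, fromEdgeSet_adj, deleteEdges_adj,
    Set.mem_insert_iff, Set.mem_singleton_iff, Sym2.eq_iff, Sum.inr.injEq, reduceCtorEq, ne_eq]
  have := hij.symm
  have := hij.ne
  grind

end IsMultiStar

/-- Removing a hub-hub edge `{i, j}` from the adjacency pattern `H` changes the class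
size by the factor `(D i − c_i + 1)(D j − c_j + 1)/s`, where `c_t = H.degree t` and
`s = ∑ t, H.degree t`: precisely,
`N(H) · s = N(H \ {i,j}) · (D i − c_i + 1) · (D j − c_j + 1)`. -/
theorem multiStarClassCard_deleteEdge {k : ℕ} (hk : 1 ≤ k) (D : Fin k → ℕ)
    (H : SimpleGraph (Fin k)) (hdeg : ∀ i, H.degree i ≤ D i)
    (i j : Fin k) (hij : i ≠ j) (hadj : H.Adj i j) :
    multiStarClassCard D H * (∑ t, H.degree t)
      = multiStarClassCard D (H.deleteEdges {s(i, j)})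
          * (D i - H.degree i + 1) * (D j - H.degree j + 1) := by
  rw [multiStarClassCard_eq_card_filter, multiStarClassCard_eq_card_filter, mul_assoc]
  rw [← Finset.sum_const_nat (f := fun G => (Finset.univ.filter
      fun p : Fin (∑ i, D i) × Fin (∑ i, D i) => G.Adj (.inl p.1) (.inl p.2)).card)
      (fun G hG => (Finset.mem_filter.mp hG).2.card_adj_leaves),
    ← Finset.sum_const_nat (f := fun G => ((Finset.univ.filter
      fun ℓ : Fin (∑ i, D i) => G.Adj (.inr i) (.inl ℓ)) ×ˢ (Finset.univ.filter
      fun ℓ : Fin (∑ i, D i) => G.Adj (.inr j) (.inl ℓ))).card) (fun G hG => ?_),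
    ← Finset.card_sigma, ← Finset.card_sigma]
  · refine Finset.card_nbij'
      (fun x => ⟨symmDiff x.1 (fourCycle (.inr i) (.inr j) (.inl x.2.2) (.inl x.2.1)), x.2⟩)
      (fun x => ⟨symmDiff x.1 (fourCycle (.inr i) (.inr j) (.inl x.2.2) (.inl x.2.1)), x.2⟩)
      ?_ ?_ ?_ ?_
    · rintro ⟨G, ℓ, ℓ'⟩ hG
      simp only [Finset.coe_sigma, Set.mem_sigma_iff, Finset.mem_coe, Finset.mem_filter,
        Finset.mem_univ, true_and, Finset.mem_product] at hG ⊢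
      obtain ⟨hG, hℓ⟩ := hG
      refine ⟨hG.switch_deleteEdges hadj hℓ, (symmDiff_adj ..).2 (.inr ⟨by simp [fourCycle], ?_⟩),
        (symmDiff_adj ..).2 (.inr ⟨by simp [fourCycle], ?_⟩)⟩
      · exact fun h => by simpa using hG.eq_of_adj h.symm hℓ
      · exact fun h => by simpa using hG.eq_of_adj h.symm hℓ.symm
    · rintro ⟨G, ℓ, ℓ'⟩ hG
      simp only [Finset.coe_sigma, Set.mem_sigma_iff, Finset.mem_coe, Finset.mem_filter,
        Finset.mem_univ, true_and, Finset.mem_product] at hG ⊢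
      obtain ⟨hG, hi, hj⟩ := hG
      have hne : ℓ ≠ ℓ' := by
        rintro rfl
        exact hij (by simpa using hG.eq_of_adj hi.symm hj.symm)
      refine ⟨hG.switch_of_deleteEdges hadj hi hj,
        (symmDiff_adj ..).2 (.inr ⟨by simp [fourCycle, hne], ?_⟩)⟩
      exact fun h => by simpa using hG.eq_of_adj h hi.symm
    · rintro ⟨G, p⟩ _
      simp
    · rintro ⟨G, p⟩ _
      simp
  · have hG := (Finset.mem_filter.mp hG).2
    have hi := hG.card_leaves_add_degree i
    have hj := hG.card_leaves_add_degree j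
    have hi' := degree_deleteEdges_add_one hadj
    have hj' := degree_deleteEdges_add_one hadj.symm
    rw [Sym2.eq_swap] at hj'
    have := hdeg i
    have := hdeg j
    rw [Finset.card_product]
    congr 1 <;> omega
end

section
/- Let n ≥ 1, let d : Fin n → ℕ with each d i ≥ 1 and Σ_i d i = 2m, and let E = Σ i, Fin (d i) be the type of edge-endpoints (the endpoint e = ⟨i, r⟩ belongs to vertex i = e.1). Let G be a simple graph on Fin n whose degree at each vertex i is d i. Then the number of fixed-point-free involutions σ of E such that for all vertices i, j, the number of endpoints e ∈ E with e.1 = i and (σ e).1 = j equals 1 if i and j are adjacent in G and 0 otherwise, is exactly ∏_i (d i)!. In other words, each simple graph with degree sequence d arises from exactly ∏_i d_i! perfect matchings in the configuration model. -/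
open Classical

namespace SimpleGraph

variable {V : Type*} {α : V → Type*} (G : SimpleGraph V)

/-- The matching of endpoints determined by identifying, at every vertex `i`, the endpoints of `i`
with the neighbors of `i`: the endpoint of `i` labelled `j` is matched with the endpoint of `j`
labelled `i`. -/
def endpointPartner (f : ∀ i, α i ≃ G.neighborSet i) (e : (i : V) × α i) : (i : V) × α i :=
  ⟨f e.1 e.2, (f (f e.1 e.2)).symm ⟨e.1, G.adj_symm (f e.1 e.2).2⟩⟩

theorem endpointPartner_eq_iff (f : ∀ i, α i ≃ G.neighborSet i) (e e' : (i : V) × α i) :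
    G.endpointPartner f e = e' ↔ (f e.1 e.2 : V) = e'.1 ∧ (f e'.1 e'.2 : V) = e.1 := by
  obtain ⟨i, r⟩ := e
  obtain ⟨j, s⟩ := e'
  constructor
  · rintro h
    obtain rfl : (f i r : V) = j := congrArg Sigma.fst h
    refine ⟨rfl, ?_⟩
    have hs : (f (f i r)).symm ⟨i, G.adj_symm (f i r).2⟩ = s := eq_of_heq (Sigma.mk.inj h).2
    simp [← hs]
  · rintro ⟨h, h'⟩
    dsimp only at h h'
    subst h
    refine Sigma.ext rfl (heq_of_eq ?_)
    exact (Equiv.symm_apply_eq _).2 (Subtype.ext h'.symm)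

theorem endpointPartner_involutive (f : ∀ i, α i ≃ G.neighborSet i) :
    Function.Involutive (G.endpointPartner f) := fun e => by
  rw [endpointPartner_eq_iff]
  exact ((G.endpointPartner_eq_iff f e _).1 rfl).symm

/-- The involutions of the endpoints whose matched pairs are exactly the edges of `G`, each edge
being represented once. -/
def IsEndpointMatching (σ : Equiv.Perm ((i : V) × α i)) : Prop :=
  (∀ e, σ (σ e) = e) ∧ (∀ e, G.Adj e.1 (σ e).1) ∧
    ∀ i j, G.Adj i j → ∃! r : α i, (σ ⟨i, r⟩).1 = j

theorem isEndpointMatching_endpointPartner (f : ∀ i, α i ≃ G.neighborSet i) :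
    G.IsEndpointMatching (G.endpointPartner_involutive f).toPerm := by
  refine ⟨G.endpointPartner_involutive f, fun e => (f e.1 e.2).2, fun i j h => ?_⟩
  refine ⟨(f i).symm ⟨j, h⟩, ?_, fun r hr => ?_⟩
  · change (f i ((f i).symm ⟨j, h⟩) : V) = j
    simp
  · exact (Equiv.eq_symm_apply _).2 (Subtype.ext hr)

variable {G} in
theorem IsEndpointMatching.bijective {σ : Equiv.Perm ((i : V) × α i)}
    (hσ : G.IsEndpointMatching σ) (i : V) :
    Function.Bijective
      (fun r : α i => (⟨(σ ⟨i, r⟩).1, hσ.2.1 ⟨i, r⟩⟩ : G.neighborSet i)) := by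
  refine ⟨fun r s h => ?_, fun j => ?_⟩
  · exact (hσ.2.2 i _ (hσ.2.1 ⟨i, s⟩)).unique (Subtype.ext_iff.1 h) rfl
  · obtain ⟨r, hr, -⟩ := hσ.2.2 i j j.2
    exact ⟨r, Subtype.ext hr⟩

theorem bijective_endpointPartner :
    Function.Bijective (fun f : ∀ i, α i ≃ G.neighborSet i =>
      (⟨(G.endpointPartner_involutive f).toPerm, G.isEndpointMatching_endpointPartner f⟩ :
        {σ : Equiv.Perm ((i : V) × α i) // G.IsEndpointMatching σ})) := by
  refine ⟨fun f g h => ?_, fun ⟨σ, hσ⟩ => ?_⟩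
  · funext i
    ext r
    exact congrArg (fun σ => (σ.1 ⟨i, r⟩).1) h
  · refine ⟨fun i => Equiv.ofBijective _ (hσ.bijective i), Subtype.ext (Equiv.ext fun e => ?_)⟩
    refine (G.endpointPartner_eq_iff (fun i => Equiv.ofBijective _ (hσ.bijective i)) e
      (σ e)).2 ⟨rfl, ?_⟩
    exact congrArg Sigma.fst (hσ.1 e)

theorem isEndpointMatching_iff_card [Fintype V] [∀ i, Fintype (α i)]
    (σ : Equiv.Perm ((i : V) × α i)) :
    G.IsEndpointMatching σ ↔ (∀ e, σ (σ e) = e) ∧ (∀ e, σ e ≠ e) ∧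
      ∀ i j : V, (Finset.univ.filter (fun e : (i : V) × α i =>
        e.1 = i ∧ (σ e).1 = j)).card = if G.Adj i j then 1 else 0 := by
  constructor
  · refine fun ⟨h, hadj, huniq⟩ => ⟨h, fun e he => G.irrefl (he ▸ hadj e), fun i j => ?_⟩
    split_ifs with hij
    · obtain ⟨r, hr, hr'⟩ := huniq i j hij
      refine Finset.card_eq_one.2 ⟨⟨i, r⟩, ?_⟩
      ext ⟨k, s⟩
      simp only [Finset.mem_filter, Finset.mem_univ, true_and, Finset.mem_singleton]
      constructor
      · rintro ⟨rfl, hs⟩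
        rw [hr' s hs]
      · rintro ⟨⟩
        exact ⟨rfl, hr⟩
    · refine Finset.card_eq_zero.2 (Finset.filter_eq_empty_iff.2 ?_)
      rintro e - ⟨rfl, rfl⟩
      exact hij (hadj e)
  · refine fun ⟨h, _, hcard⟩ => ⟨h, fun e => ?_, fun i j hij => ?_⟩
    · by_contra hne
      have h0 := hcard e.1 (σ e).1
      rw [if_neg hne, Finset.card_eq_zero, Finset.filter_eq_empty_iff] at h0
      exact h0 (Finset.mem_univ e) ⟨rfl, rfl⟩
    · have h1 := hcard i j
      rw [if_pos hij, Finset.card_eq_one] at h1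
      obtain ⟨⟨k, r⟩, hr⟩ := h1
      simp only [Finset.ext_iff, Finset.mem_filter, Finset.mem_univ, true_and,
        Finset.mem_singleton] at hr
      obtain ⟨rfl, hj⟩ := (hr ⟨k, r⟩).2 rfl
      exact ⟨r, hj, fun s hs => eq_of_heq (Sigma.mk.inj ((hr ⟨k, s⟩).1 ⟨rfl, hs⟩)).2⟩

end SimpleGraph

/-- In the configuration model, each simple graph `G` with degree sequence `d` arises
from exactly `∏ i, (d i)!` perfect matchings: the number of fixed-point-free
involutions `σ` of the edge-endpoint set `E = Σ i, Fin (d i)` such that, for all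
vertices `i, j`, the number of endpoints of `i` matched into `j` is `1` if `i` and `j`
are adjacent in `G` and `0` otherwise, is `∏ i, (d i)!`. -/
theorem card_matchings_yielding_simple_graph
    (n m : ℕ) (hn : 1 ≤ n) (d : Fin n → ℕ) (hd : ∀ i, 1 ≤ d i)
    (hsum : ∑ i, d i = 2 * m)
    (G : SimpleGraph (Fin n)) (hG : ∀ i, G.degree i = d i) :
    Fintype.card {σ : Equiv.Perm ((i : Fin n) × Fin (d i)) //
        (∀ e, σ (σ e) = e) ∧ (∀ e, σ e ≠ e) ∧
        ∀ i j : Fin n,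
          (Finset.univ.filter (fun e : (i : Fin n) × Fin (d i) =>
            e.1 = i ∧ (σ e).1 = j)).card = if G.Adj i j then 1 else 0}
      = ∏ i, (d i).factorial := by
  have e (i : Fin n) : Fin (d i) ≃ G.neighborSet i :=
    Fintype.equivOfCardEq (by rw [Fintype.card_fin, G.card_neighborSet_eq_degree, hG])
  calc
    _ = Fintype.card (∀ i, Fin (d i) ≃ G.neighborSet i) := by
      refine Fintype.card_congr (Equiv.trans (Equiv.subtypeEquivRight fun σ => ?_)
        (Equiv.ofBijective _ G.bijective_endpointPartner).symm)
      rw [G.isEndpointMatching_iff_card]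
      convert Iff.rfl
    _ = ∏ i, (d i).factorial := by
      rw [Fintype.card_pi]
      refine Finset.prod_congr rfl fun i _ => ?_
      rw [Fintype.card_equiv (e i), Fintype.card_fin]
end
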